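/- arXiv:1501.05873 — 3 statements merged into one kernel-verified Lean document; each statement's English description precedes it below -/
import Mathlib

section
/- Let α > 0, let ν be a symmetric probability measure on ℝ with ν({0}) = 0, let G(t) = ∫_ℝ (1 − |x/t|^α)₊ ν(dx) for t > 0, and for n ≥ 2 let F_n(t) = ν^{▵_α n}((−∞,t]) be the cumulative distribution function of the n-fold Kendall convolution power of ν. Then ∫_ℝ (1 − |xs|^α)₊ ν^{▵_α n}(dx) = ( ∫_ℝ (1 − |xs|^α)₊ ν(dx) )ⁿ for all s ∈ ℝ, and consequently 2α ∫₀ᵗ x^{α−1} F_n(x) dx = t^α (G(t)ⁿ + 1) for every t > 0. -/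
open MeasureTheory

/-- `Ψ(t) = (1 - |t|^α)₊`. -/
noncomputable def Psi (α t : ℝ) : ℝ := max (1 - |t| ^ α) 0

/-- The Williamson transform of a measure on `ℝ`. -/
noncomputable def williamson (α : ℝ) (ν : Measure ℝ) (t : ℝ) : ℝ :=
  ∫ x, Psi α (x * t) ∂ν

/-- A measure on `ℝ` is symmetric if it is invariant under `x ↦ -x`. -/
def IsSymmetric (ν : Measure ℝ) : Prop := ν.map (fun x => -x) = ν

/-- The rescaling operator `T_a`: `(T_a λ)(A) = λ(A / a)` for `a ≠ 0`, `T_0 λ = δ_0`. -/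
noncomputable def rescale (a : ℝ) (μ : Measure ℝ) : Measure ℝ :=
  if a = 0 then Measure.dirac 0 else μ.map (fun x => a * x)

/-- `δ̃_x = (δ_x + δ_{-x})/2`. -/
noncomputable def deltaTilde (x : ℝ) : Measure ℝ :=
  (2 : ENNReal)⁻¹ • (Measure.dirac x + Measure.dirac (-x))

/-- The symmetric Pareto measure `π̃_{2α}` with density `α |y|^{-2α-1} 1_{|y| ≥ 1}`. -/
noncomputable def pareto (α : ℝ) : Measure ℝ :=
  volume.withDensity fun y =>
    ENNReal.ofReal (if 1 ≤ |y| then α * |y| ^ (-2 * α - 1) else 0)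

/-- Kendall convolution of two symmetric two-point masses:
`δ̃_x ▵_α δ̃_y = T_M (ϱ^α π̃_{2α} + (1 - ϱ^α) δ̃_1)`. -/
noncomputable def kendallPoint (α x y : ℝ) : Measure ℝ :=
  let M := max |x| |y|
  let m := min |x| |y|
  let ρ := if M = 0 then 0 else m / M
  rescale M (ENNReal.ofReal (ρ ^ α) • pareto α +
    ENNReal.ofReal (1 - ρ ^ α) • deltaTilde 1)

/-- Kendall convolution of two measures on `ℝ`:
`(ν₁ ▵_α ν₂)(A) = ∫∫ (δ̃_x ▵_α δ̃_y)(A) ν₁(dx) ν₂(dy)`. -/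
noncomputable def kendall (α : ℝ) (ν₁ ν₂ : Measure ℝ) : Measure ℝ :=
  ν₁.bind fun x => ν₂.bind fun y => kendallPoint α x y

/-- `n`-fold Kendall convolution power `ν^{▵_α n}`. -/
noncomputable def kendallPow (α : ℝ) (ν : Measure ℝ) : ℕ → Measure ℝ
  | 0 => Measure.dirac 0
  | 1 => ν
  | n + 2 => kendall α (kendallPow α ν (n + 1)) ν

/-- The one-step kernel of the Kendall random walk: `K(x, ·) = δ̃_x ▵_α ν`. -/
noncomputable def kendallKernel (α : ℝ) (ν : Measure ℝ) (x : ℝ) : Measure ℝ :=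
  ν.bind fun y => kendallPoint α x y

/-- `excursion α ν n` is the sub-probability distribution of `X_{n+1}` on the event
`X₁ ≤ 0, …, X_n ≤ 0` for the Kendall random walk started at `0`, so that
`Φ_{n+1}(t) = excursion α ν n ((0,t))`. -/
noncomputable def excursion (α : ℝ) (ν : Measure ℝ) : ℕ → Measure ℝ
  | 0 => ν
  | n + 1 => ((excursion α ν n).restrict (Set.Iic 0)).bind (kendallKernel α ν)

lemma hasDerivAt_max_sq (x : ℝ) : HasDerivAt (fun x : ℝ => (max x 0) ^ 2) (2 * max x 0) x := by
  rcases lt_trichotomy x 0 with h | h | h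
  · rw [max_eq_right h.le]
    have : (fun x : ℝ => (max x 0) ^ 2) =ᶠ[nhds x] fun _ => 0 := by
      filter_upwards [Iio_mem_nhds h] with y hy
      rw [max_eq_right (le_of_lt hy)]; simp
    simpa using (hasDerivAt_const x (0 : ℝ)).congr_of_eventuallyEq this
  · subst h
    rw [hasDerivAt_iff_isLittleO]
    simp only [max_self, mul_zero, sub_zero, smul_zero]
    have h1 : (fun x : ℝ => (max x 0) ^ 2 - 0 ^ 2) =O[nhds 0] fun x : ℝ => x ^ 2 := by
      refine Asymptotics.IsBigO.of_bound 1 (Filter.Eventually.of_forall fun y => ?_)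
      rcases le_total y 0 with h | h <;> simp [h, sq_nonneg]
    refine h1.trans_isLittleO ?_
    simpa using (Asymptotics.isLittleO_pow_id (𝕜 := ℝ) (n := 2) (by norm_num))
  · rw [max_eq_left h.le]
    have : (fun x : ℝ => (max x 0) ^ 2) =ᶠ[nhds x] fun x => x ^ 2 := by
      filter_upwards [Ioi_mem_nhds h] with y hy
      rw [max_eq_left (le_of_lt hy)]
    simpa using (hasDerivAt_pow 2 x).congr_of_eventuallyEq this

lemma lintegral_even (f : ℝ → ENNReal) (hf : ∀ x, f (-x) = f x) :
    ∫⁻ x, f x = 2 * ∫⁻ x in Set.Ioi 0, f x := by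
  rw [← lintegral_add_compl f (measurableSet_Ioi (a := (0 : ℝ))), two_mul]
  congr 1
  rw [Set.compl_Ioi, setLIntegral_congr Iio_ae_eq_Iic.symm]
  have := (Measure.measurePreserving_neg (volume : Measure ℝ)).setLIntegral_comp_preimage_emb
    (MeasurableEquiv.neg ℝ).measurableEmbedding f (Set.Ioi 0)
  rw [← this]
  simp [hf]

lemma measurable_Psi (α : ℝ) : Measurable (Psi α) := by
  unfold Psi; fun_prop

lemma Psi_abs (α t : ℝ) : Psi α |t| = Psi α t := by simp [Psi]

lemma Psi_nonneg (α t : ℝ) : 0 ≤ Psi α t := le_max_right _ _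

lemma lintegral_pareto_core (α : ℝ) (hα : 0 < α) (c : ℝ) (hc : 0 ≤ c) :
    ∫⁻ z in Set.Ioi (1 : ℝ), ENNReal.ofReal (α * z ^ (-α - 1) * max (z ^ (-α) - c) 0) =
      ENNReal.ofReal ((max (1 - c) 0) ^ 2 / 2) := by
  set F : ℝ → ℝ := fun z => -((max (z ^ (-α) - c) 0) ^ 2 / 2) with hF
  have hd : ∀ z ∈ Set.Ici (1 : ℝ),
      HasDerivAt F (α * z ^ (-α - 1) * max (z ^ (-α) - c) 0) z := by
    intro z hz
    have hz0 : (0 : ℝ) < z := lt_of_lt_of_le one_pos hz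
    have h1 : HasDerivAt (fun z : ℝ => z ^ (-α) - c) (-α * z ^ (-α - 1)) z :=
      (Real.hasDerivAt_rpow_const (Or.inl hz0.ne')).sub_const c
    have h2 := (hasDerivAt_max_sq (z ^ (-α) - c)).comp z h1
    refine ((h2.div_const 2).neg).congr_deriv ?_
    ring
  have hn : ∀ z ∈ Set.Ioi (1 : ℝ), 0 ≤ α * z ^ (-α - 1) * max (z ^ (-α) - c) 0 := by
    intro z hz
    have hz0 : (0 : ℝ) < z := lt_trans one_pos hz
    positivity
  have ht : Filter.Tendsto F Filter.atTop (nhds 0) := by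
    have h1 : Filter.Tendsto (fun z : ℝ => z ^ (-α)) Filter.atTop (nhds 0) :=
      tendsto_rpow_neg_atTop hα
    have h2 : Continuous fun w : ℝ => -((max (w - c) 0) ^ 2 / 2) := by fun_prop
    have := (h2.tendsto 0).comp h1
    have e : -(max (0 - c) 0 ^ 2 / 2) = 0 := by simp [hc]
    rw [e] at this
    exact this
  have hcont : ContinuousWithinAt F (Set.Ici 1) 1 :=
    (hd 1 Set.self_mem_Ici).continuousAt.continuousWithinAt
  have hi := integrableOn_Ioi_deriv_of_nonneg hcont (fun z hz => hd z (Set.mem_Ici.2 (le_of_lt (Set.mem_Ioi.1 hz)))) hn ht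
  have hv := integral_Ioi_of_hasDerivAt_of_nonneg hcont (fun z hz => hd z (Set.mem_Ici.2 (le_of_lt (Set.mem_Ioi.1 hz)))) hn ht
  rw [← ofReal_integral_eq_lintegral_ofReal hi, hv]
  · simp [hF]
  · exact (ae_restrict_iff' measurableSet_Ioi).2 (Filter.Eventually.of_forall hn)

lemma measurable_pareto_density (α : ℝ) : Measurable fun y : ℝ =>
    ENNReal.ofReal (if 1 ≤ |y| then α * |y| ^ (-2 * α - 1) else 0) := by
  refine ENNReal.measurable_ofReal.comp (Measurable.ite ?_ (by fun_prop) measurable_const)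
  exact measurableSet_le measurable_const (by fun_prop)

lemma lintegral_pareto (α : ℝ) (hα : 0 < α) (u : ℝ) :
    ∫⁻ z, ENNReal.ofReal (Psi α (z * u)) ∂(pareto α) = ENNReal.ofReal ((Psi α u) ^ 2) := by
  have hm : Measurable fun z => ENNReal.ofReal (Psi α (z * u)) :=
    ENNReal.measurable_ofReal.comp ((measurable_Psi α).comp (by fun_prop))
  rw [pareto, lintegral_withDensity_eq_lintegral_mul _ (measurable_pareto_density α) hm,
    lintegral_even]
  swap
  · intro x; simp [Psi]
  have hsplit : ∀ f : ℝ → ENNReal, (∀ x ∈ Set.Ioo (0 : ℝ) 1, f x = 0) →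
      ∫⁻ x in Set.Ioi 0, f x = ∫⁻ x in Set.Ioi 1, f x := by
    intro f hf
    rw [← Set.Ioc_union_Ioi_eq_Ioi zero_le_one,
      lintegral_union measurableSet_Ioi Set.Ioc_disjoint_Ioi_same,
      setLIntegral_congr Ioo_ae_eq_Ioc.symm, setLIntegral_congr_fun measurableSet_Ioo hf]
    simp
  rw [hsplit]
  swap
  · rintro x ⟨h0, h1⟩
    simp [abs_of_pos h0, not_le.2 h1]
  have : ∀ x ∈ Set.Ioi (1 : ℝ), ((fun y : ℝ =>
      ENNReal.ofReal (if 1 ≤ |y| then α * |y| ^ (-2 * α - 1) else 0)) *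
        fun z => ENNReal.ofReal (Psi α (z * u))) x =
      ENNReal.ofReal (α * x ^ (-α - 1) * max (x ^ (-α) - |u| ^ α) 0) := by
    intro x hx
    have hx1 : (1 : ℝ) < x := hx
    have hx0 : (0 : ℝ) < x := lt_trans one_pos hx
    simp only [Pi.mul_apply, abs_of_pos hx0, hx1.le, if_true]
    rw [← ENNReal.ofReal_mul (by positivity)]
    congr 1
    rw [Psi, abs_mul, abs_of_pos hx0, Real.mul_rpow hx0.le (abs_nonneg u),
      show -2 * α - 1 = (-α - 1) + -α by ring, Real.rpow_add hx0, mul_assoc, mul_assoc, mul_assoc,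
      mul_max_of_nonneg _ _ (by positivity : 0 ≤ x ^ (-α)), mul_sub, ← mul_assoc (x ^ (-α)),
      ← Real.rpow_add hx0]
    simp
  rw [setLIntegral_congr_fun measurableSet_Ioi this,
    lintegral_pareto_core α hα _ (by positivity)]
  rw [show (2 : ENNReal) = ENNReal.ofReal 2 by simp, ← ENNReal.ofReal_mul (by norm_num)]
  congr 1
  rw [Psi]; ring

lemma pareto_univ (α : ℝ) (hα : 0 < α) : pareto α Set.univ = 1 := by
  have := lintegral_pareto α hα 0
  simpa [Psi, hα.ne'] using this

lemma pareto_prob (α : ℝ) (hα : 0 < α) : IsProbabilityMeasure (pareto α) := ⟨pareto_univ α hα⟩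

lemma pareto_neg (α : ℝ) : (pareto α).map (fun x => -x) = pareto α := by
  ext A hA
  have hn : Measurable fun x : ℝ => -x := measurable_neg
  rw [Measure.map_apply hn hA, pareto, withDensity_apply _ (hn hA), withDensity_apply _ hA]
  have := (Measure.measurePreserving_neg (volume : Measure ℝ)).setLIntegral_comp_preimage_emb
    (MeasurableEquiv.neg ℝ).measurableEmbedding (fun y : ℝ =>
    ENNReal.ofReal (if 1 ≤ |y| then α * |y| ^ (-2 * α - 1) else 0)) A
  rw [← this]
  simp

/-- uniform description of `kendallPoint`. -/
noncomputable def rhoA (α x y : ℝ) : ℝ := (min |x| |y| / max |x| |y|) ^ α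

lemma measurable_rhoA (α : ℝ) : Measurable fun p : ℝ × ℝ => rhoA α p.1 p.2 := by
  unfold rhoA; fun_prop

lemma rhoA_nonneg (α x y : ℝ) : 0 ≤ rhoA α x y := by
  unfold rhoA; positivity

lemma rhoA_le_one (α : ℝ) (hα : 0 < α) (x y : ℝ) : rhoA α x y ≤ 1 := by
  unfold rhoA
  refine Real.rpow_le_one (by positivity) ?_ hα.le
  exact div_le_one_of_le₀ min_le_max (by positivity)

lemma kendallPoint_eq (α : ℝ) (hα : 0 < α) (x y : ℝ) :
    kendallPoint α x y = ENNReal.ofReal (rhoA α x y) • (pareto α).map (fun z => max |x| |y| * z) +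
      ENNReal.ofReal (1 - rhoA α x y) • deltaTilde (max |x| |y|) := by
  by_cases hM : max |x| |y| = 0
  · have h2 : (2 : ENNReal)⁻¹ + 2⁻¹ = 1 := ENNReal.inv_two_add_inv_two
    simp only [kendallPoint, rescale, hM, if_true, rhoA, div_zero, Real.zero_rpow hα.ne',
      deltaTilde]
    ext A hA
    simp [← two_mul, ← mul_assoc, ENNReal.mul_inv_cancel]
  · have hm : Measurable fun z : ℝ => max |x| |y| * z := by fun_prop
    simp only [kendallPoint, rescale, hM, if_false, rhoA, deltaTilde]
    rw [Measure.map_add _ _ hm, Measure.map_smul, Measure.map_smul, Measure.map_smul,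
      Measure.map_add _ _ hm, Measure.map_dirac' hm, Measure.map_dirac' hm]
    simp

lemma measurable_kendallPoint (α : ℝ) (hα : 0 < α) :
    Measurable fun p : ℝ × ℝ => kendallPoint α p.1 p.2 := by
  have := pareto_prob α hα
  refine Measure.measurable_of_measurable_coe _ fun A hA => ?_
  simp only [kendallPoint_eq α hα]
  have hr := measurable_rhoA α
  have h1 : Measurable fun p : ℝ × ℝ => (pareto α).map (fun z => max |p.1| |p.2| * z) A := by
    have hs : MeasurableSet {q : (ℝ × ℝ) × ℝ | max |q.1.1| |q.1.2| * q.2 ∈ A} :=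
      (show Measurable fun q : (ℝ × ℝ) × ℝ => max |q.1.1| |q.1.2| * q.2 by fun_prop) hA
    have := measurable_measure_prodMk_left (ν := pareto α) hs
    have e : (fun p : ℝ × ℝ => (pareto α).map (fun z => max |p.1| |p.2| * z) A) =
        fun p => pareto α (Prod.mk p ⁻¹' {q : (ℝ × ℝ) × ℝ | max |q.1.1| |q.1.2| * q.2 ∈ A}) := by
      ext p
      rw [Measure.map_apply (by fun_prop) hA]
      rfl
    rw [e]
    exact this
  have h2 : Measurable fun p : ℝ × ℝ => deltaTilde (max |p.1| |p.2|) A := by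
    simp only [deltaTilde, Measure.smul_apply, Measure.add_apply, Measure.dirac_apply' _ hA,
      smul_eq_mul]
    have hi : Measurable (A.indicator (1 : ℝ → ENNReal)) := measurable_one.indicator hA
    have ha := hi.comp (show Measurable fun p : ℝ × ℝ => max |p.1| |p.2| by fun_prop)
    have hb := hi.comp (show Measurable fun p : ℝ × ℝ => -max |p.1| |p.2| by fun_prop)
    exact (ha.add hb).const_mul _
  simp only [Measure.add_apply, Measure.smul_apply, smul_eq_mul]
  exact ((ENNReal.measurable_ofReal.comp hr).mul h1).add
    ((ENNReal.measurable_ofReal.comp (hr.const_sub 1)).mul h2)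

lemma measurable_ofPsi (α s : ℝ) : Measurable fun z => ENNReal.ofReal (Psi α (z * s)) :=
  ENNReal.measurable_ofReal.comp ((measurable_Psi α).comp (by fun_prop))

lemma Psi_alg (α : ℝ) (hα : 0 < α) (M m s : ℝ) (hM : 0 ≤ M) (hm : 0 ≤ m) (hmM : m ≤ M) :
    (m / M) ^ α * (Psi α (M * s)) ^ 2 + (1 - (m / M) ^ α) * Psi α (M * s) =
      Psi α (M * s) * Psi α (m * s) := by
  rcases hM.eq_or_lt with h | h
  · subst h
    have : m = 0 := le_antisymm hmM hm
    subst this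
    simp [Psi, hα.ne']
  by_cases h1 : |M * s| ^ α ≤ 1
  · have e : |m * s| ^ α = (m / M) ^ α * |M * s| ^ α := by
      rw [← Real.mul_rpow (by positivity) (by positivity), abs_mul, abs_mul, abs_of_nonneg hm,
        abs_of_pos h]
      congr 1; field_simp
    have hr : (m / M) ^ α ≤ 1 :=
      Real.rpow_le_one (by positivity) (div_le_one_of_le₀ hmM hM) hα.le
    have h0 : 0 ≤ |M * s| ^ α := by positivity
    have hr0 : 0 ≤ (m / M) ^ α := by positivity
    unfold Psi
    rw [e, max_eq_left (by linarith), max_eq_left (by nlinarith)]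
    ring
  · have : Psi α (M * s) = 0 := max_eq_right (by linarith)
    simp [this]

lemma lintegral_kendallPoint (α : ℝ) (hα : 0 < α) (x y s : ℝ) :
    ∫⁻ z, ENNReal.ofReal (Psi α (z * s)) ∂(kendallPoint α x y) =
      ENNReal.ofReal (Psi α (x * s)) * ENNReal.ofReal (Psi α (y * s)) := by
  have hm := measurable_ofPsi α s
  rw [kendallPoint_eq α hα, lintegral_add_measure, lintegral_smul_measure, lintegral_smul_measure,
    lintegral_map hm (by fun_prop), deltaTilde, lintegral_smul_measure, lintegral_add_measure,
    lintegral_dirac' _ hm, lintegral_dirac' _ hm]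
  have h1 : ∀ z : ℝ, max |x| |y| * z * s = z * (max |x| |y| * s) := fun z => by ring
  simp only [h1, lintegral_pareto α hα]
  have h2 : Psi α (-max |x| |y| * s) = Psi α (max |x| |y| * s) := by
    rw [neg_mul, ← Psi_abs, abs_neg, Psi_abs]
  rw [h2, ← two_mul, smul_eq_mul, smul_eq_mul, smul_eq_mul, ← mul_assoc (2 : ENNReal)⁻¹,
    ENNReal.inv_mul_cancel (by simp) (by simp), one_mul]
  have hr := rhoA_nonneg α x y
  have hr1 := rhoA_le_one α hα x y
  have hp := Psi_nonneg α (max |x| |y| * s)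
  rw [← ENNReal.ofReal_mul hr, ← ENNReal.ofReal_mul (by linarith),
    ← ENNReal.ofReal_add (by positivity) (mul_nonneg (by linarith) hp),
    ← ENNReal.ofReal_mul (Psi_nonneg _ _)]
  congr 1
  rw [rhoA, Psi_alg α hα _ _ s (by positivity) (by positivity) min_le_max]
  have h3 : ∀ w : ℝ, Psi α (|w| * s) = Psi α (w * s) := fun w => by simp [Psi, abs_mul]
  rcases le_total |x| |y| with h | h
  · rw [max_eq_right h, min_eq_left h, h3, h3, mul_comm]
  · rw [max_eq_left h, min_eq_right h, h3, h3]

lemma measurable_inner (α : ℝ) (hα : 0 < α) (ν : Measure ℝ) [SFinite ν] :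
    Measurable fun x => ν.bind fun y => kendallPoint α x y := by
  refine Measure.measurable_of_measurable_coe _ fun A hA => ?_
  have hk := measurable_kendallPoint α hα
  have h : ∀ x, (ν.bind fun y => kendallPoint α x y) A = ∫⁻ y, kendallPoint α x y A ∂ν := fun x =>
    Measure.bind_apply hA (hk.comp (measurable_prodMk_left (x := x))).aemeasurable
  simp only [h]
  exact ((Measure.measurable_coe hA).comp hk).lintegral_prod_right'

lemma lintegral_kendall (α : ℝ) (hα : 0 < α) (μ ν : Measure ℝ) [SFinite ν] (s : ℝ) :
    ∫⁻ z, ENNReal.ofReal (Psi α (z * s)) ∂(kendall α μ ν) =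
      (∫⁻ z, ENNReal.ofReal (Psi α (z * s)) ∂μ) * ∫⁻ z, ENNReal.ofReal (Psi α (z * s)) ∂ν := by
  have hm := measurable_ofPsi α s
  have hk := measurable_kendallPoint α hα
  rw [kendall, Measure.lintegral_bind (measurable_inner α hα ν).aemeasurable hm.aemeasurable]
  have h : ∀ x, ∫⁻ z, ENNReal.ofReal (Psi α (z * s)) ∂(ν.bind fun y => kendallPoint α x y) =
      ENNReal.ofReal (Psi α (x * s)) * ∫⁻ z, ENNReal.ofReal (Psi α (z * s)) ∂ν := fun x => by
    have hx : Measurable fun y => kendallPoint α x y := hk.comp (measurable_prodMk_left (x := x))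
    rw [Measure.lintegral_bind hx.aemeasurable hm.aemeasurable]
    simp only [lintegral_kendallPoint α hα]
    rw [lintegral_const_mul _ hm]
  simp only [h]
  rw [lintegral_mul_const _ hm]

lemma kendallPoint_neg (α : ℝ) (hα : 0 < α) (x y : ℝ) :
    (kendallPoint α x y).map (fun z => -z) = kendallPoint α x y := by
  have hn : Measurable fun z : ℝ => -z := measurable_neg
  have hm : Measurable fun z : ℝ => max |x| |y| * z := by fun_prop
  rw [kendallPoint_eq α hα, Measure.map_add _ _ hn, Measure.map_smul, Measure.map_smul]
  congr 2
  · conv_rhs => rw [← pareto_neg α]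
    rw [Measure.map_map hn hm, Measure.map_map hm hn]
    congr 1; ext z; simp
  · rw [deltaTilde, Measure.map_smul, Measure.map_add _ _ hn, Measure.map_dirac' hn,
      Measure.map_dirac' hn, neg_neg, add_comm]

lemma kendall_neg (α : ℝ) (hα : 0 < α) (μ ν : Measure ℝ) [SFinite ν] :
    (kendall α μ ν).map (fun z => -z) = kendall α μ ν := by
  have hn : Measurable fun z : ℝ => -z := measurable_neg
  have hk := measurable_kendallPoint α hα
  ext A hA
  have hi := (measurable_inner α hα ν).aemeasurable (μ := μ)
  rw [Measure.map_apply hn hA, kendall, Measure.bind_apply (hn hA) hi, Measure.bind_apply hA hi]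
  refine lintegral_congr fun x => ?_
  have hx : AEMeasurable (fun y => kendallPoint α x y) ν :=
    (hk.comp (measurable_prodMk_left (x := x))).aemeasurable
  rw [Measure.bind_apply (hn hA) hx, Measure.bind_apply hA hx]
  refine lintegral_congr fun y => ?_
  rw [← Measure.map_apply hn hA]
  exact congrArg (fun m : Measure ℝ => m A) (kendallPoint_neg α hα x y)

lemma lintegral_kendallPow (α : ℝ) (hα : 0 < α) (ν : Measure ℝ) [SFinite ν] (s : ℝ) (n : ℕ) :
    ∫⁻ z, ENNReal.ofReal (Psi α (z * s)) ∂(kendallPow α ν (n + 1)) =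
      (∫⁻ z, ENNReal.ofReal (Psi α (z * s)) ∂ν) ^ (n + 1) := by
  induction n with
  | zero => simp [kendallPow]
  | succ n ih => rw [kendallPow, lintegral_kendall α hα, ih, ← pow_succ]

lemma kendallPow_prob (α : ℝ) (hα : 0 < α) (ν : Measure ℝ) [IsProbabilityMeasure ν] (n : ℕ) :
    IsProbabilityMeasure (kendallPow α ν (n + 1)) := by
  have := lintegral_kendallPow α hα ν 0 n
  constructor
  simpa [Psi, hα.ne'] using this

lemma integral_kendallPow (α : ℝ) (hα : 0 < α) (ν : Measure ℝ) [SFinite ν] (s : ℝ) (n : ℕ) :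
    ∫ z, Psi α (z * s) ∂(kendallPow α ν (n + 1)) = (∫ z, Psi α (z * s) ∂ν) ^ (n + 1) := by
  have hm : Measurable fun z => Psi α (z * s) := (measurable_Psi α).comp (by fun_prop)
  rw [integral_eq_lintegral_of_nonneg_ae (Filter.Eventually.of_forall fun _ => Psi_nonneg _ _)
    hm.aestronglyMeasurable,
    integral_eq_lintegral_of_nonneg_ae (Filter.Eventually.of_forall fun _ => Psi_nonneg _ _)
    hm.aestronglyMeasurable, lintegral_kendallPow α hα, ENNReal.toReal_pow]

lemma integral_tail (α : ℝ) (hα : 0 < α) (μ : Measure ℝ) [IsProbabilityMeasure μ] (t : ℝ)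
    (ht : 0 < t) :
    α * ∫ x in Set.Ioo 0 t, x ^ (α - 1) * (μ {z | x < |z|}).toReal =
      ∫ z, (min |z| t) ^ α ∂μ := by
  have hmeas : Measurable fun x : ℝ => (μ {z | x < |z|}).toReal := by
    apply Antitone.measurable
    intro a b hab
    exact ENNReal.toReal_mono (measure_ne_top _ _) (measure_mono fun z hz => lt_of_le_of_lt hab hz)
  have hf : Measurable fun z : ℝ => min |z| t := by fun_prop
  rw [integral_eq_lintegral_of_nonneg_ae, integral_eq_lintegral_of_nonneg_ae,
    lintegral_rpow_eq_lintegral_meas_lt_mul μ _ hf.aemeasurable hα, ENNReal.toReal_mul,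
    ENNReal.toReal_ofReal hα.le]
  · congr 2
    rw [← Set.Ioo_union_Ici_eq_Ioi ht, lintegral_union measurableSet_Ici
      (by rw [Set.disjoint_left]; rintro x ⟨_, h1⟩ h2; exact absurd h1 (not_lt.2 h2))]
    rw [setLIntegral_congr_fun (g := fun _ => 0) measurableSet_Ici]
    · simp only [lintegral_zero, add_zero]
      refine setLIntegral_congr_fun measurableSet_Ioo fun x hx => ?_
      have : {a : ℝ | x < min |a| t} = {z | x < |z|} := by
        ext z; simp [hx.2]
      simp only [this]
      rw [mul_comm (x ^ _), ENNReal.ofReal_mul ENNReal.toReal_nonneg,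
        ENNReal.ofReal_toReal (measure_ne_top _ _)]
    · intro x hx
      have : {a : ℝ | x < min |a| t} = ∅ := by
        ext z
        have : t ≤ x := hx
        simp; intro _; exact this
      simp only [this, measure_empty, zero_mul]
  · exact Filter.Eventually.of_forall fun z => by simp; positivity
  · exact Filter.Eventually.of_forall fun z => by simp; positivity
  · exact (hf.pow_const α).aestronglyMeasurable
  · exact (ae_restrict_iff' measurableSet_Ioo).2 (Filter.Eventually.of_forall fun x hx => by
      have := hx.1
      simp; positivity)
  · exact ((measurable_id.pow_const _).mul hmeas).aestronglyMeasurable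

lemma cdf_sym (μ : Measure ℝ) [IsProbabilityMeasure μ] (hs : μ.map (fun z => -z) = μ)
    (x : ℝ) (hx : 0 < x) :
    (μ (Set.Iic x)).toReal = 1 - (μ {z | x < |z|}).toReal / 2 := by
  have hn : Measurable fun z : ℝ => -z := measurable_neg
  have h1 : {z : ℝ | x < |z|} = Set.Ioi x ∪ (fun z => -z) ⁻¹' Set.Ioi x := by
    ext z; simp [lt_abs, lt_neg]
  have h2 : μ ((fun z => -z) ⁻¹' Set.Ioi x) = μ (Set.Ioi x) := by
    rw [← Measure.map_apply hn measurableSet_Ioi, hs]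
  have h3 : μ {z | x < |z|} = μ (Set.Ioi x) + μ (Set.Ioi x) := by
    rw [h1, measure_union _ (hn measurableSet_Ioi), h2]
    rw [Set.disjoint_left]
    intro z h1 h2
    simp at h1 h2
    linarith
  have h4 : (μ (Set.Iic x)).toReal = 1 - (μ (Set.Ioi x)).toReal := by
    rw [← Set.compl_Ioi]
    exact probReal_compl_eq_one_sub measurableSet_Ioi
  rw [h3, ENNReal.toReal_add (measure_ne_top _ _) (measure_ne_top _ _), h4]
  ring

lemma cdf_identity (α : ℝ) (hα : 0 < α) (μ : Measure ℝ) [IsProbabilityMeasure μ]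
    (hs : μ.map (fun z => -z) = μ) (t : ℝ) (ht : 0 < t) :
    2 * α * ∫ x in (0 : ℝ)..t, x ^ (α - 1) * (μ (Set.Iic x)).toReal =
      t ^ α * ((∫ z, Psi α (z * t⁻¹) ∂μ) + 1) := by
  have hmeas : Measurable fun x : ℝ => (μ {z | x < |z|}).toReal := by
    apply Antitone.measurable
    intro a b hab
    exact ENNReal.toReal_mono (measure_ne_top _ _) (measure_mono fun z hz => lt_of_le_of_lt hab hz)
  have hi : IntervalIntegrable (fun x : ℝ => x ^ (α - 1)) volume 0 t :=
    intervalIntegral.intervalIntegrable_rpow' (by linarith)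
  have hi1 : IntegrableOn (fun x : ℝ => x ^ (α - 1)) (Set.Ioo 0 t) :=
    ((intervalIntegrable_iff_integrableOn_Ioc_of_le ht.le).1 hi).mono_set Set.Ioo_subset_Ioc_self
  have hi2 : IntegrableOn (fun x : ℝ => x ^ (α - 1) * (μ {z | x < |z|}).toReal) (Set.Ioo 0 t) := by
    refine Integrable.mul_bdd (c := 1) hi1 hmeas.aestronglyMeasurable
      (Filter.Eventually.of_forall fun x => ?_)
    rw [Real.norm_of_nonneg ENNReal.toReal_nonneg]
    exact measureReal_le_one
  have hv : ∫ x in Set.Ioo 0 t, x ^ (α - 1) = t ^ α / α := by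
    rw [← integral_Ioc_eq_integral_Ioo, ← intervalIntegral.integral_of_le ht.le,
      integral_rpow (Or.inl (by linarith))]
    simp [hα.ne']
  have hT := integral_tail α hα μ t ht
  rw [intervalIntegral.integral_of_le ht.le, integral_Ioc_eq_integral_Ioo,
    setIntegral_congr_fun (g := fun x => x ^ (α - 1) -
      (1 / 2) * (x ^ (α - 1) * (μ {z | x < |z|}).toReal)) measurableSet_Ioo
      (fun x hx => by simp only [cdf_sym μ hs x hx.1]; ring),
    integral_sub hi1 (hi2.const_mul _), integral_const_mul, hv]
  have hP : ∀ z, t ^ α * Psi α (z * t⁻¹) = t ^ α - (min |z| t) ^ α := by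
    intro z
    have htα : 0 < t ^ α := by positivity
    rw [Psi, abs_mul, abs_of_pos (inv_pos.2 ht), Real.mul_rpow (abs_nonneg _) (by positivity),
      Real.inv_rpow ht.le, mul_max_of_nonneg _ _ htα.le, mul_sub, mul_zero, mul_one]
    rw [show t ^ α * (|z| ^ α * (t ^ α)⁻¹) = |z| ^ α by field_simp]
    rcases le_total |z| t with h | h
    · have := Real.rpow_le_rpow (abs_nonneg z) h hα.le
      rw [min_eq_left h, max_eq_left (by linarith)]
    · have := Real.rpow_le_rpow ht.le h hα.le
      rw [min_eq_right h, max_eq_right (by linarith)]; ring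
  have hint : Integrable (fun z : ℝ => (min |z| t) ^ α) μ := by
    have hf : Measurable fun z : ℝ => (min |z| t) ^ α := by fun_prop
    refine Integrable.of_bound hf.aestronglyMeasurable (t ^ α)
      (Filter.Eventually.of_forall fun z => ?_)
    have : 0 ≤ min |z| t := by positivity
    rw [Real.norm_of_nonneg (by positivity)]
    exact Real.rpow_le_rpow this (min_le_right _ _) hα.le
  have hE : t ^ α * ∫ z, Psi α (z * t⁻¹) ∂μ = t ^ α - ∫ z, (min |z| t) ^ α ∂μ := by
    rw [← integral_const_mul]
    simp only [hP]
    rw [integral_sub (integrable_const _) hint]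
    simp
  rw [mul_add, hE, ← hT]
  field_simp
  ring

/-- The Williamson transform of the `n`-fold Kendall convolution power is the `n`-th power
of the Williamson transform, and consequently the CDF `F_n` of `ν^{▵_α n}` satisfies
`2α ∫₀ᵗ x^{α-1} F_n(x) dx = t^α (G(t)^n + 1)` for `t > 0`. -/
theorem kendallPow_cdf_identity (α : ℝ) (hα : 0 < α)
    (ν : Measure ℝ) [IsProbabilityMeasure ν] (hsym : IsSymmetric ν) (h0 : ν {0} = 0)
    (G : ℝ → ℝ) (hG : ∀ t : ℝ, 0 < t → G t = ∫ x, max (1 - |x / t| ^ α) 0 ∂ν)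
    (n : ℕ) (hn : 2 ≤ n) :
    (∀ s : ℝ,
      ∫ x, max (1 - |x * s| ^ α) 0 ∂(kendallPow α ν n) =
        (∫ x, max (1 - |x * s| ^ α) 0 ∂ν) ^ n) ∧
    (∀ t : ℝ, 0 < t →
      2 * α * ∫ x in (0 : ℝ)..t, x ^ (α - 1) * ((kendallPow α ν n) (Set.Iic x)).toReal =
        t ^ α * ((G t) ^ n + 1)) := by

  obtain ⟨k, rfl⟩ : ∃ k, n = k + 2 := ⟨n - 2, by omega⟩
  have h1 := fun s => integral_kendallPow α hα ν s (k + 1)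
  refine ⟨h1, fun t ht => ?_⟩
  have := kendallPow_prob α hα ν (k + 1)
  have h2 := cdf_identity α hα (kendallPow α ν (k + 2))
    (kendall_neg α hα (kendallPow α ν (k + 1)) ν) t ht
  rw [h2, h1, hG t ht]
  rfl
end

section
/- Let α > 0 and n ≥ 2 a natural number. The n-fold Kendall convolution power δ̃₁^{▵_α n} of δ̃₁ = (δ₁ + δ_{−1})/2 equals the measure on ℝ with density (α n(n−1)/2) |t|^{−2α−1} (1 − |t|^{−α})^{n−2} · 1{|t| ≥ 1} with respect to Lebesgue measure; in particular this density integrates to 1. -/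
open MeasureTheory

lemma kd_even (F : ℝ → ENNReal) (hF : Measurable F) :
    ∫⁻ x, F |x| = 2 * ∫⁻ x in Set.Ioi (0:ℝ), F x := by
  rw [← lintegral_add_compl _ (measurableSet_Ioi (a := (0:ℝ))), two_mul]
  congr 1
  · exact setLIntegral_congr_fun measurableSet_Ioi (fun x hx => by
      rw [abs_of_pos hx])
  · rw [Set.compl_Ioi]
    have h := (Measure.measurePreserving_neg (volume : Measure ℝ)).setLIntegral_comp_preimage
      (measurableSet_Iio (a := (0:ℝ))) (f := fun x => F |x|) (by fun_prop)
    rw [setLIntegral_congr Iio_ae_eq_Iic.symm, ← h]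
    have : (Neg.neg ⁻¹' Set.Iio (0:ℝ)) = Set.Ioi 0 := by ext; simp
    rw [this]
    exact setLIntegral_congr_fun measurableSet_Ioi (fun x hx => by
      simp only [abs_neg]
      rw [abs_of_pos hx])

noncomputable def kdDens (α : ℝ) (n : ℕ) (t : ℝ) : ℝ :=
  if 1 ≤ |t| then
    α * n * ((n : ℝ) - 1) / 2 * |t| ^ (-2 * α - 1) * (1 - |t| ^ (-α)) ^ (n - 2)
  else 0

lemma kd_meas (α : ℝ) (n : ℕ) : Measurable (kdDens α n) := by
  unfold kdDens
  refine Measurable.ite (measurableSet_le measurable_const (by fun_prop)) ?_ measurable_const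
  fun_prop

lemma kd_one_sub {α : ℝ} (hα : 0 < α) {t : ℝ} (ht : 1 ≤ t) : 0 ≤ 1 - t ^ (-α) := by
  have := Real.rpow_le_one_of_one_le_of_nonpos ht (by linarith : -α ≤ 0)
  linarith

lemma kd_hasDeriv (α : ℝ) {t : ℝ} (ht : 0 < t) :
    HasDerivAt (fun x : ℝ => x ^ (-α)) (-α * t ^ (-α - 1)) t :=
  Real.hasDerivAt_rpow_const (Or.inl ht.ne')

lemma kd_inner (α : ℝ) (hα : 0 < α) (m : ℕ) (y : ℝ) (hy : 1 ≤ y) :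
    ∫⁻ x : ℝ, ENNReal.ofReal (if 1 ≤ |x| ∧ |x| ≤ y then
      α * (m + 2) * (m + 1) / 2 * |x| ^ (-α - 1) * (1 - |x| ^ (-α)) ^ m else 0) =
    ENNReal.ofReal ((m + 2) * (1 - y ^ (-α)) ^ (m + 1)) := by
  rw [kd_even (fun x => ENNReal.ofReal (if 1 ≤ x ∧ x ≤ y then
      α * (m + 2) * (m + 1) / 2 * x ^ (-α - 1) * (1 - x ^ (-α)) ^ m else 0))]
  swap
  · refine Measurable.ennreal_ofReal (Measurable.ite measurableSet_Icc ?_ measurable_const)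
    fun_prop
  have e1 : ∫⁻ x in Set.Ioi (0:ℝ), ENNReal.ofReal (if 1 ≤ x ∧ x ≤ y then
      α * (m + 2) * (m + 1) / 2 * x ^ (-α - 1) * (1 - x ^ (-α)) ^ m else 0) =
      ∫⁻ x in Set.Ioc (1:ℝ) y, ENNReal.ofReal (
      α * (m + 2) * (m + 1) / 2 * x ^ (-α - 1) * (1 - x ^ (-α)) ^ m) := by
    rw [setLIntegral_congr (Ioc_ae_eq_Icc (a := (1:ℝ)) (b := y)),
      ← lintegral_indicator measurableSet_Icc, ← lintegral_indicator measurableSet_Ioi]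
    congr 1
    ext x
    by_cases hx : 1 ≤ x ∧ x ≤ y
    · rw [Set.indicator_of_mem (show x ∈ Set.Ioi (0:ℝ) by simp; linarith [hx.1]),
        Set.indicator_of_mem (show x ∈ Set.Icc 1 y from hx), if_pos hx]
    · rw [Set.indicator_of_notMem (show x ∉ Set.Icc 1 y from hx)]
      simp [hx]
  have hc : ContinuousOn (fun x : ℝ => α * (m + 2) * (m + 1) / 2 * x ^ (-α - 1) *
      (1 - x ^ (-α)) ^ m) (Set.Icc 1 y) := by
    have h0 : ∀ x ∈ Set.Icc (1:ℝ) y, x ≠ 0 := fun x hx => by linarith [hx.1] |> fun h : 0 < x => h.ne'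
    have h1 : ∀ p : ℝ, ContinuousOn (fun x : ℝ => x ^ p) (Set.Icc 1 y) := fun p =>
      continuousOn_id.rpow_const (fun x hx => Or.inl (h0 x hx))
    exact (continuousOn_const.mul (h1 _)).mul ((continuousOn_const.sub (h1 _)).pow m)
  have hi := hc.integrableOn_Icc (μ := volume)
  have e2 : ∫ x in Set.Ioc (1:ℝ) y, (
      α * (m + 2) * (m + 1) / 2 * x ^ (-α - 1) * (1 - x ^ (-α)) ^ m) =
      (m + 2) / 2 * (1 - y ^ (-α)) ^ (m + 1) := by
    rw [← intervalIntegral.integral_of_le hy,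
      intervalIntegral.integral_eq_sub_of_hasDerivAt
        (f := fun x : ℝ => ((m:ℝ) + 2) / 2 * (1 - x ^ (-α)) ^ (m + 1))]
    · simp
    · intro x hx
      rw [Set.uIcc_of_le hy] at hx
      have := (((kd_hasDeriv α (by linarith [hx.1] : 0 < x)).const_sub 1).pow (m+1)).const_mul
        (((m:ℝ) + 2) / 2)
      refine this.congr_deriv ?_
      push_cast
      ring
    · rw [intervalIntegrable_iff_integrableOn_Icc_of_le hy]
      exact hi
  rw [e1, ← ofReal_integral_eq_lintegral_ofReal (hi.mono_set Set.Ioc_subset_Icc_self), e2]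
  · rw [show (2:ENNReal) = ENNReal.ofReal 2 by simp, ← ENNReal.ofReal_mul (by norm_num)]
    congr 1
    ring
  · refine (ae_restrict_mem measurableSet_Ioc).mono (fun x hx => ?_)
    have := kd_one_sub hα hx.1.le
    have h3 : (0:ℝ) < x := by linarith [hx.1]
    simp only [Pi.zero_apply]
    positivity

lemma kd_mass (α : ℝ) (hα : 0 < α) (m : ℕ) :
    ∫⁻ x : ℝ, ENNReal.ofReal (kdDens α (m + 2) x) = 1 := by
  have e0 : ∀ x, kdDens α (m+2) x = (fun x => if 1 ≤ x then
      α * (m + 2) * (m + 1) / 2 * x ^ (-2 * α - 1) * (1 - x ^ (-α)) ^ m else 0) |x| := by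
    intro x
    simp only [kdDens, Nat.add_sub_cancel]
    push_cast
    congr 1
    ring
  simp_rw [e0]
  rw [kd_even (fun x => ENNReal.ofReal (if 1 ≤ x then
      α * (m + 2) * (m + 1) / 2 * x ^ (-2 * α - 1) * (1 - x ^ (-α)) ^ m else 0))]
  swap
  · refine Measurable.ennreal_ofReal (Measurable.ite measurableSet_Ici ?_ measurable_const)
    fun_prop
  have e1 : ∫⁻ x in Set.Ioi (0:ℝ), ENNReal.ofReal (if 1 ≤ x then
      α * (m + 2) * (m + 1) / 2 * x ^ (-2 * α - 1) * (1 - x ^ (-α)) ^ m else 0) =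
      ∫⁻ x in Set.Ioi (1:ℝ), ENNReal.ofReal (
      α * (m + 2) * (m + 1) / 2 * x ^ (-2 * α - 1) * (1 - x ^ (-α)) ^ m) := by
    rw [setLIntegral_congr (Ioi_ae_eq_Ici (a := (1:ℝ))),
      ← lintegral_indicator measurableSet_Ici, ← lintegral_indicator measurableSet_Ioi]
    congr 1
    ext x
    by_cases hx : 1 ≤ x
    · rw [Set.indicator_of_mem (show x ∈ Set.Ioi (0:ℝ) by simp; linarith),
        Set.indicator_of_mem (show x ∈ Set.Ici 1 from hx), if_pos hx]
    · rw [Set.indicator_of_notMem (show x ∉ Set.Ici 1 from hx)]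
      simp [hx]
  have hd : ∀ x ∈ Set.Ici (1:ℝ), HasDerivAt
      (fun x : ℝ => ((m:ℝ) + 2) / 2 * (x ^ (-α) * (1 - x ^ (-α)) ^ (m + 1))
        + 1 / 2 * (1 - x ^ (-α)) ^ (m + 2))
      (α * (m + 2) * (m + 1) / 2 * x ^ (-2 * α - 1) * (1 - x ^ (-α)) ^ m) x := by
    intro x hx
    have hx0 : 0 < x := lt_of_lt_of_le one_pos hx
    have h := kd_hasDeriv α hx0
    have := ((h.mul ((h.const_sub 1).pow (m+1))).const_mul (((m:ℝ) + 2) / 2)).add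
      (((h.const_sub 1).pow (m+2)).const_mul (1/2 : ℝ))
    refine this.congr_deriv ?_
    rw [show (-2 * α - 1) = -α + (-α - 1) by ring, Real.rpow_add hx0]
    push_cast
    simp only [Pi.pow_apply]
    ring
  have hp : ∀ x ∈ Set.Ioi (1:ℝ),
      0 ≤ (α * (m + 2) * (m + 1) / 2 * x ^ (-2 * α - 1) * (1 - x ^ (-α)) ^ m) := by
    intro x hx
    have := kd_one_sub hα (le_of_lt hx)
    have h3 : (0:ℝ) < x := one_pos.trans hx
    positivity
  have hl : Filter.Tendsto (fun x : ℝ => ((m:ℝ) + 2) / 2 * (x ^ (-α) * (1 - x ^ (-α)) ^ (m + 1))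
        + 1 / 2 * (1 - x ^ (-α)) ^ (m + 2)) Filter.atTop (nhds (1/2)) := by
    have h := tendsto_rpow_neg_atTop hα
    have := ((h.mul ((h.const_sub 1).pow (m+1))).const_mul (((m:ℝ) + 2) / 2)).add
      (((h.const_sub 1).pow (m+2)).const_mul (1/2 : ℝ))
    simpa using this
  rw [e1, ← ofReal_integral_eq_lintegral_ofReal (integrableOn_Ioi_deriv_of_nonneg' hd hp hl),
    integral_Ioi_of_hasDerivAt_of_nonneg' hd hp hl]
  · rw [show (2:ENNReal) = ENNReal.ofReal 2 by simp, ← ENNReal.ofReal_mul (by norm_num)]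
    simp
  · exact (ae_restrict_mem measurableSet_Ioi).mono hp

lemma kd_bind (κ : ℝ → Measure ℝ) (h : κ (-1) = κ 1) : (deltaTilde 1).bind κ = κ 1 := by
  have hm : AEMeasurable κ (deltaTilde 1) := by
    unfold deltaTilde
    exact (AEMeasurable.add_measure aemeasurable_dirac aemeasurable_dirac).smul_measure _
  ext s hs
  rw [Measure.bind_apply hs hm]
  unfold deltaTilde
  rw [lintegral_smul_measure, lintegral_add_measure, lintegral_dirac, lintegral_dirac, h,
    smul_eq_mul, ← two_mul, ← mul_assoc, ENNReal.inv_mul_cancel (by simp) (by simp), one_mul]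

noncomputable def kdK (α : ℝ) (x : ℝ) : Measure ℝ :=
  ENNReal.ofReal (|x| ^ (-α)) • (pareto α).map (fun y => |x| * y) +
    ENNReal.ofReal (1 - |x| ^ (-α)) • deltaTilde |x|

instance kd_sfinite (α : ℝ) : SFinite (pareto α) := by unfold pareto; infer_instance

lemma kd_point (α x : ℝ) (hx : 1 ≤ |x|) : kendallPoint α x 1 = kdK α x := by
  have h0 : |x| ≠ 0 := by positivity
  have hm : Measurable (fun y : ℝ => |x| * y) := by fun_prop
  simp only [kendallPoint, rescale, abs_one, max_eq_left hx, min_eq_right hx, if_neg h0, kdK]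
  rw [Measure.map_add _ _ hm, Measure.map_smul, Measure.map_smul, one_div,
    Real.inv_rpow (abs_nonneg x), ← Real.rpow_neg (abs_nonneg x)]
  congr 2
  unfold deltaTilde
  rw [Measure.map_smul, Measure.map_add _ _ hm, Measure.map_dirac' hm, Measure.map_dirac' hm]
  simp

lemma kd_point_neg (α x : ℝ) : kendallPoint α x (-1) = kendallPoint α x 1 := by
  simp [kendallPoint]

lemma kdK_apply (α x : ℝ) (s : Set ℝ) (hs : MeasurableSet s) : kdK α x s =
    ENNReal.ofReal (|x| ^ (-α)) * ∫⁻ y, s.indicator 1 (|x| * y) ∂(pareto α) +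
    ENNReal.ofReal (1 - |x| ^ (-α)) * (2⁻¹ * (s.indicator 1 x + s.indicator 1 (-x))) := by
  have hm : Measurable (fun y : ℝ => |x| * y) := by fun_prop
  have h1 : (s.indicator 1 |x| + s.indicator 1 (-|x|) : ENNReal)
      = s.indicator 1 x + s.indicator 1 (-x) := by
    rcases abs_cases x with h | h <;> rw [h.1]
    rw [neg_neg, add_comm]
  simp only [kdK, deltaTilde, Measure.add_apply, Measure.smul_apply, smul_eq_mul,
    Measure.dirac_apply' _ hs, h1]
  congr 2
  rw [Measure.map_apply hm hs, ← lintegral_indicator_one (hm hs)]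
  rfl

lemma kdK_meas (α : ℝ) : Measurable (kdK α) := by
  refine Measure.measurable_of_measurable_coe _ (fun s hs => ?_)
  simp_rw [kdK_apply α _ s hs]
  have hi : Measurable (s.indicator (1 : ℝ → ENNReal)) := measurable_one.indicator hs
  have h1 : Measurable fun x : ℝ => ∫⁻ y, s.indicator (1 : ℝ → ENNReal) (|x| * y) ∂(pareto α) :=
    Measurable.lintegral_prod_right' (f := fun p : ℝ × ℝ => s.indicator (1 : ℝ → ENNReal) (|p.1| * p.2))
      (hi.comp (by fun_prop))
  have h2 : Measurable fun x : ℝ => s.indicator (1 : ℝ → ENNReal) (-x) := hi.comp measurable_neg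
  fun_prop

lemma kd_pareto (α : ℝ) (c : ℝ) (hc : 0 < c) (s : Set ℝ) (hs : MeasurableSet s) :
    ∫⁻ y, s.indicator 1 (c * y) ∂(pareto α) =
    ∫⁻ y in s, ENNReal.ofReal (if c ≤ |y| then α * c ^ (2 * α) * |y| ^ (-2 * α - 1) else 0) := by
  have hi : Measurable (s.indicator (1 : ℝ → ENNReal)) := measurable_one.indicator hs
  have hpm : Measurable fun y : ℝ =>
      ENNReal.ofReal (if 1 ≤ |y| then α * |y| ^ (-2 * α - 1) else 0) := by
    refine Measurable.ennreal_ofReal (Measurable.ite (measurableSet_le measurable_const (by fun_prop)) ?_ measurable_const)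
    fun_prop
  have hg : Measurable fun y : ℝ =>
      ENNReal.ofReal (if c ≤ |y| then α * c ^ (2 * α) * |y| ^ (-2 * α - 1) else 0) := by
    refine Measurable.ennreal_ofReal (Measurable.ite (measurableSet_le measurable_const (by fun_prop)) ?_ measurable_const)
    fun_prop
  unfold pareto
  rw [lintegral_withDensity_eq_lintegral_mul _ hpm (show Measurable (fun y => s.indicator (1 : ℝ → ENNReal) (c * y)) from hi.comp (by fun_prop)),
    ← lintegral_indicator hs]
  conv_rhs => rw [← Real.smul_map_volume_mul_left hc.ne']
  rw [lintegral_smul_measure, lintegral_map (hg.indicator hs) (by fun_prop), smul_eq_mul,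
    ← lintegral_const_mul' _ _ ENNReal.ofReal_ne_top]
  congr 1
  ext y
  by_cases h : c * y ∈ s
  · have h2 : c ≤ |c * y| ↔ 1 ≤ |y| := by
      rw [abs_mul, abs_of_pos hc]
      exact le_mul_iff_one_le_right hc
    simp only [Pi.mul_apply, Set.indicator_of_mem h, Pi.one_apply, mul_one, h2, Function.comp]
    rw [← ENNReal.ofReal_mul (abs_nonneg _)]
    split_ifs with h3
    · rw [abs_mul, abs_of_pos hc, Real.mul_rpow hc.le (abs_nonneg _)]
      congr 1
      have : c * (c ^ (2 * α) * c ^ (-2 * α - 1)) = 1 := by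
        rw [← Real.rpow_add hc, show 2 * α + (-2 * α - 1) = -1 by ring, Real.rpow_neg_one,
          mul_inv_cancel₀ hc.ne']
      linear_combination (-α * |y| ^ (-2 * α - 1)) * this
    · simp
  · simp [Set.indicator_of_notMem h]

lemma kd_step (α : ℝ) (hα : 0 < α) (m : ℕ) (s : Set ℝ) (hs : MeasurableSet s) :
    ∫⁻ x, ENNReal.ofReal (kdDens α (m + 2) x) * kdK α x s =
    ∫⁻ x in s, ENNReal.ofReal (kdDens α (m + 3) x) := by
  have hi : Measurable (s.indicator (1 : ℝ → ENNReal)) := measurable_one.indicator hs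
  have hd := (kd_meas α (m+2)).ennreal_ofReal
  -- the joint integrand
  let H : ℝ → ℝ → ENNReal := fun x y => ENNReal.ofReal (α * |y| ^ (-2 * α - 1)) *
    ENNReal.ofReal (if 1 ≤ |x| ∧ |x| ≤ |y| then
      α * (m + 2) * (m + 1) / 2 * |x| ^ (-α - 1) * (1 - |x| ^ (-α)) ^ m else 0)
  have hH : Measurable (Function.uncurry H) := by
    have hset : MeasurableSet {p : ℝ × ℝ | 1 ≤ |p.1| ∧ |p.1| ≤ |p.2|} :=
      MeasurableSet.inter (s₁ := {p : ℝ × ℝ | 1 ≤ |p.1|}) (s₂ := {p : ℝ × ℝ | |p.1| ≤ |p.2|})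
        (measurableSet_le (by fun_prop) (by fun_prop))
        (measurableSet_le (by fun_prop) (by fun_prop))
    have h1 : Measurable fun p : ℝ × ℝ => ENNReal.ofReal (α * |p.2| ^ (-2 * α - 1)) := by fun_prop
    have h2 : Measurable fun p : ℝ × ℝ => ENNReal.ofReal (if 1 ≤ |p.1| ∧ |p.1| ≤ |p.2| then
      α * (m + 2) * (m + 1) / 2 * |p.1| ^ (-α - 1) * (1 - |p.1| ^ (-α)) ^ m else 0) :=
      Measurable.ennreal_ofReal (Measurable.ite hset (by fun_prop) measurable_const)
    exact h1.mul h2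
  let B : ℝ → ENNReal := fun x => ENNReal.ofReal (kdDens α (m + 2) x) *
    ENNReal.ofReal (1 - |x| ^ (-α))
  have hB : Measurable B := hd.mul (by fun_prop)
  have hBe : ∀ x, B (-x) = B x := by intro x; simp [B, kdDens]
  have key : ∀ x, ENNReal.ofReal (kdDens α (m + 2) x) * kdK α x s =
      (∫⁻ y in s, H x y) + 2⁻¹ * (s.indicator B x + s.indicator B (-x)) := by
    intro x
    rw [kdK_apply α x s hs, mul_add]
    congr 1
    · by_cases hx : 1 ≤ |x|
      · have hx0 : 0 < |x| := by linarith
        rw [kd_pareto α _ hx0 s hs, ← mul_assoc, ← lintegral_const_mul]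
        swap
        · refine Measurable.ennreal_ofReal (Measurable.ite (measurableSet_le measurable_const (by fun_prop)) ?_ measurable_const)
          fun_prop
        congr 1
        ext y
        have h1 := kd_one_sub hα hx
        have hk : 0 ≤ kdDens α (m+2) x := by
          simp only [kdDens, if_pos hx, Nat.add_sub_cancel]
          push_cast
          rw [show (m:ℝ) + 2 - 1 = m + 1 by ring]
          positivity
        simp only [H]
        rw [← ENNReal.ofReal_mul hk, ← ENNReal.ofReal_mul (by positivity),
          ← ENNReal.ofReal_mul (by positivity)]
        congr 1
        simp only [kdDens, hx, true_and, if_true, Nat.add_sub_cancel]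
        split_ifs with h
        · push_cast
          have : |x| ^ (-2 * α - 1) * |x| ^ (-α) * |x| ^ (2 * α) = |x| ^ (-α - 1) := by
            rw [← Real.rpow_add hx0, ← Real.rpow_add hx0]
            congr 1
            ring
          rw [← this]
          ring
        · simp
      · simp [H, kdDens, hx]
    · rw [← mul_assoc, mul_left_comm]
      congr 1
      rw [mul_add]
      congr 1
      · by_cases h : x ∈ s <;> simp [h, B]
      · by_cases h : -x ∈ s <;> simp [h, B, kdDens]
  simp_rw [key]
  have hBs := hB.indicator hs
  have hBn : Measurable fun x => s.indicator B (-x) := hBs.comp measurable_neg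
  rw [lintegral_add_right _ (by fun_prop), lintegral_const_mul _ (by fun_prop),
    lintegral_add_left hBs, lintegral_neg_eq_self (fun x => s.indicator B x), ← two_mul, ← mul_assoc,
    ENNReal.inv_mul_cancel (by simp) (by simp), one_mul, lintegral_indicator hs,
    lintegral_lintegral_swap hH.aemeasurable, ← lintegral_add_right _ hB]
  congr 1
  ext y
  simp only [H, B]
  rw [lintegral_const_mul]
  swap
  · have hset : MeasurableSet {x : ℝ | 1 ≤ |x| ∧ |x| ≤ |y|} :=
      MeasurableSet.inter (s₁ := {x : ℝ | 1 ≤ |x|}) (s₂ := {x : ℝ | |x| ≤ |y|})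
        (measurableSet_le (by fun_prop) (by fun_prop))
        (measurableSet_le (by fun_prop) (by fun_prop))
    exact Measurable.ennreal_ofReal (Measurable.ite hset (by fun_prop) measurable_const)
  by_cases hy : 1 ≤ |y|
  · have h1 := kd_one_sub hα hy
    have hk : 0 ≤ kdDens α (m+2) y := by
      simp only [kdDens, if_pos hy, Nat.add_sub_cancel]
      push_cast
      rw [show (m:ℝ) + 2 - 1 = m + 1 by ring]
      positivity
    rw [kd_inner α hα m _ hy, ← ENNReal.ofReal_mul (by positivity), ← ENNReal.ofReal_mul hk,
      ← ENNReal.ofReal_add (by positivity) (by positivity)]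
    congr 1
    simp only [kdDens, if_pos hy, Nat.add_sub_cancel, show m + 3 - 2 = m + 1 from rfl]
    push_cast
    ring
  · have : ∀ x : ℝ, ¬ (1 ≤ |x| ∧ |x| ≤ |y|) := fun x h => hy (h.1.trans h.2)
    simp [kdDens, hy, this]

lemma kd_main (α : ℝ) (hα : 0 < α) (m : ℕ) : kendallPow α (deltaTilde 1) (m + 2) =
    volume.withDensity (fun t => ENNReal.ofReal (kdDens α (m + 2) t)) := by
  have hk : ∀ x, (deltaTilde 1).bind (fun y => kendallPoint α x y) = kendallPoint α x 1 :=
    fun x => kd_bind _ (kd_point_neg α x)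
  induction m with
  | zero =>
    simp only [kendallPow, kendall, hk]
    rw [kd_bind]
    · simp [kendallPoint, rescale, pareto, kdDens]
      norm_num
    · simp [kendallPoint]
  | succ m ih =>
    rw [kendallPow, kendall, ih]
    simp only [hk]
    have hd := (kd_meas α (m+2)).ennreal_ofReal
    have hae : (fun x => kendallPoint α x 1) =ᵐ[volume.withDensity
        (fun t => ENNReal.ofReal (kdDens α (m + 2) t))] kdK α := by
      rw [Filter.EventuallyEq, ae_withDensity_iff hd]
      refine Filter.Eventually.of_forall (fun x hx => kd_point α x ?_)
      by_contra h
      simp [kdDens, h] at hx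
    rw [Measure.bind_congr_right hae]
    ext s hs
    rw [Measure.bind_apply hs (kdK_meas α).aemeasurable, withDensity_apply _ hs,
      lintegral_withDensity_eq_lintegral_mul _ hd (show Measurable (fun x => kdK α x s) from (Measure.measurable_coe hs).comp (kdK_meas α))]
    exact kd_step α hα m s hs

/-- For `n ≥ 2`, the `n`-fold Kendall convolution power of `δ̃₁` has density
`(α n (n-1)/2) |t|^{-2α-1} (1 - |t|^{-α})^{n-2} 1_{|t| ≥ 1}`, and this density
integrates to `1`. -/
theorem kendallPow_deltaTilde_density (α : ℝ) (hα : 0 < α) (n : ℕ) (hn : 2 ≤ n) :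
    kendallPow α (deltaTilde 1) n =
      volume.withDensity (fun t =>
        ENNReal.ofReal (if 1 ≤ |t| then
          α * n * ((n : ℝ) - 1) / 2 * |t| ^ (-2 * α - 1) * (1 - |t| ^ (-α)) ^ (n - 2)
          else 0)) ∧
    ∫⁻ t : ℝ, ENNReal.ofReal (if 1 ≤ |t| then
        α * n * ((n : ℝ) - 1) / 2 * |t| ^ (-2 * α - 1) * (1 - |t| ^ (-α)) ^ (n - 2)
        else 0) = 1 := by
  obtain ⟨m, rfl⟩ := Nat.exists_eq_add_of_le' hn
  exact ⟨kd_main α hα m, kd_mass α hα m⟩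
end

section
/- Let α > 0, let ν be a symmetric probability measure on ℝ with ν({0}) = 0, with cumulative distribution function F, and let G(t) = ∫_ℝ (1 − |x/t|^α)₊ ν(dx) for t > 0. Then ∫₀^∞ α t^{α−1} ( 1 − (4F(t) − 2 − G(t)²)/(2 − G(t))² ) dt = 4 ∫_{(0,∞)} u^α ν(du), as an identity in [0,∞] (no finiteness of the right-hand side is assumed). Equivalently, the position X_{τ₀⁺} of the Kendall random walk with step distribution ν started at 0 at the first hitting time τ₀⁺ of (0,∞) satisfies E[ X_{τ₀⁺}^α ] = 2 E|Y₁|^α, where Y₁ ∼ ν. -/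
open MeasureTheory

open Set Filter Topology in
lemma hpm_tail (ν : Measure ℝ) [IsProbabilityMeasure ν] (hsym : IsSymmetric ν)
    (t : ℝ) (ht : 0 ≤ t) :
    ν {x | t < |x|} = ENNReal.ofReal (2 - 2 * (ν (Iic t)).toReal) := by
  have h1 : {x : ℝ | t < |x|} = Ioi t ∪ Iio (-t) := by
    ext x
    simp only [mem_ofPred_eq, lt_abs, mem_union, mem_Ioi, mem_Iio]
    constructor <;> (rintro (h | h) <;> [left; right] <;> linarith)
  have h2 : ν (Iio (-t)) = ν (Ioi t) := by
    conv_rhs => rw [← hsym]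
    rw [Measure.map_apply measurable_neg measurableSet_Ioi]
    congr 1
    ext x; simp only [mem_Iio, mem_preimage, mem_Ioi]
    constructor <;> intro h <;> linarith
  have h3 : Disjoint (Ioi t) (Iio (-t)) := by
    rw [Set.disjoint_left]
    intro x hx hx'
    simp only [mem_Ioi, mem_Iio] at hx hx'
    linarith
  rw [h1, measure_union h3 measurableSet_Iio, h2, ← two_mul]
  have h4 : (ν (Ioi t)).toReal = 1 - (ν (Iic t)).toReal := by
    rw [← compl_Iic]
    exact probReal_compl_eq_one_sub measurableSet_Iic
  rw [show 2 - 2 * (ν (Iic t)).toReal = 2 * (1 - (ν (Iic t)).toReal) by ring, ← h4,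
    ENNReal.ofReal_mul (by norm_num), ENNReal.ofReal_toReal (measure_ne_top _ _)]
  norm_num

open Set Filter Topology in
lemma hpm_sym (α : ℝ) (hα : 0 < α) (ν : Measure ℝ) (hsym : IsSymmetric ν) :
    ∫⁻ x, ENNReal.ofReal (|x| ^ α) ∂ν = 2 * ∫⁻ u in Ioi (0 : ℝ), ENNReal.ofReal (u ^ α) ∂ν := by
  have hm : Measurable fun x : ℝ => ENNReal.ofReal (|x| ^ α) := by fun_prop
  have e1 : ∫⁻ x in Ioi 0, ENNReal.ofReal (|x| ^ α) ∂ν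
      = ∫⁻ u in Ioi (0 : ℝ), ENNReal.ofReal (u ^ α) ∂ν :=
    setLIntegral_congr_fun measurableSet_Ioi fun x hx => by
      simp only [abs_of_pos (mem_Ioi.1 hx)]
  have e2 : ∫⁻ x in Iio 0, ENNReal.ofReal (|x| ^ α) ∂ν
      = ∫⁻ x in Ioi 0, ENNReal.ofReal (|x| ^ α) ∂ν := by
    conv_rhs => rw [← hsym]
    rw [setLIntegral_map measurableSet_Ioi hm measurable_neg]
    have : (fun x : ℝ => -x) ⁻¹' Ioi 0 = Iio 0 := by ext; simp
    rw [this]; simp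
  have e3 : ∫⁻ x in ({0} : Set ℝ), ENNReal.ofReal (|x| ^ α) ∂ν = 0 := by
    rw [setLIntegral_congr_fun (g := fun _ => 0) (measurableSet_singleton 0)]
    · simp
    · intro x hx
      simp only [mem_singleton_iff] at hx
      simp [hx, Real.zero_rpow hα.ne']
  have e4 : ∫⁻ x in Iic 0, ENNReal.ofReal (|x| ^ α) ∂ν
      = ∫⁻ x in Ioi 0, ENNReal.ofReal (|x| ^ α) ∂ν := by
    rw [← Iio_union_right, lintegral_union (measurableSet_singleton 0) (by simp), e3, e2, add_zero]
  rw [← lintegral_add_compl _ (measurableSet_Ioi (a := (0:ℝ))), compl_Ioi, e4, e1, two_mul]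

open Set Filter Topology in
lemma hpm_B (α : ℝ) (hα : 0 < α) (ν : Measure ℝ) [IsProbabilityMeasure ν]
    (t : ℝ) (ht : 0 < t) :
    ENNReal.ofReal (t ^ α * (1 - ∫ x, max (1 - |x / t| ^ α) 0 ∂ν))
      = ∫⁻ x, ENNReal.ofReal ((min |x| t) ^ α) ∂ν := by
  have hT : 0 < t ^ α := by positivity
  have hb : ∀ x : ℝ, 0 ≤ max (1 - |x / t| ^ α) 0 ∧ max (1 - |x / t| ^ α) 0 ≤ 1 := fun x =>
    ⟨le_max_right _ _, max_le (by have : 0 ≤ |x / t| ^ α := by positivity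
                                  linarith) zero_le_one⟩
  have hi : Integrable (fun x : ℝ => max (1 - |x / t| ^ α) 0) ν := by
    refine Integrable.of_bound (C := 1) (Measurable.aestronglyMeasurable (by fun_prop)) (Eventually.of_forall fun x => ?_)
    rw [Real.norm_of_nonneg (hb x).1]; exact (hb x).2
  have hpt : ∀ x : ℝ, (min |x| t) ^ α = t ^ α * (1 - max (1 - |x / t| ^ α) 0) := by
    intro x
    rw [abs_div, abs_of_pos ht, Real.div_rpow (abs_nonneg _) ht.le]
    rcases le_total |x| t with h | h
    · have : |x| ^ α ≤ t ^ α := Real.rpow_le_rpow (abs_nonneg _) h hα.le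
      rw [min_eq_left h, max_eq_left (by rw [sub_nonneg, div_le_one hT]; exact this)]
      field_simp; ring
    · have : t ^ α ≤ |x| ^ α := Real.rpow_le_rpow ht.le h hα.le
      rw [min_eq_right h, max_eq_right (by rw [sub_nonpos, one_le_div hT]; exact this)]
      ring
  simp_rw [hpt]
  rw [← ofReal_integral_eq_lintegral_ofReal]
  · rw [integral_const_mul, integral_sub (integrable_const _) hi]; simp
  · exact ((integrable_const _).sub hi).const_mul _
  · exact Eventually.of_forall fun x => mul_nonneg hT.le (by linarith [(hb x).2])

open Set Filter Topology in
lemma hpm_layer (α : ℝ) (hα : 0 < α) (ν : Measure ℝ) [IsProbabilityMeasure ν]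
    (hsym : IsSymmetric ν) (t : ℝ) (ht : 0 < t) :
    ∫⁻ x, ENNReal.ofReal ((min |x| t) ^ α) ∂ν
      = ∫⁻ s in Ioc 0 t, ENNReal.ofReal (α * s ^ (α - 1) * (2 - 2 * (ν (Iic s)).toReal)) := by
  rw [lintegral_rpow_eq_lintegral_meas_lt_mul ν
    (Eventually.of_forall fun x => le_min (abs_nonneg x) ht.le) (by fun_prop) hα,
    ← lintegral_const_mul' _ _ ENNReal.ofReal_ne_top]
  have hst : Ioo 0 t ⊆ Ioi (0:ℝ) := fun x hx => hx.1
  rw [← Measure.restrict_congr_set Ioo_ae_eq_Ioc, ← inter_eq_left.2 hst,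
    ← Measure.restrict_restrict measurableSet_Ioo, ← lintegral_indicator measurableSet_Ioo]
  refine setLIntegral_congr_fun measurableSet_Ioi fun s hs => ?_
  have hs : 0 < s := hs
  by_cases h : s < t
  · rw [indicator_of_mem (show s ∈ Ioo 0 t from ⟨hs, h⟩)]
    have : {a : ℝ | s < min |a| t} = {a | s < |a|} := by ext; simp [h]
    simp only [this]
    rw [hpm_tail ν hsym s hs.le, mul_comm (ENNReal.ofReal (2 - _)), ← mul_assoc,
      ← ENNReal.ofReal_mul hα.le, ← ENNReal.ofReal_mul (by positivity)]
  · rw [indicator_of_notMem (fun hh => h hh.2)]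
    have : {a : ℝ | s < min |a| t} = ∅ := by ext; simp [h]
    simp only [this, measure_empty, zero_mul, mul_zero]

open Set Filter Topology in
lemma hpm_bint (α : ℝ) (hα : 0 < α) (ν : Measure ℝ) [IsProbabilityMeasure ν] (a b : ℝ) :
    IntervalIntegrable (fun s : ℝ => α * s ^ (α - 1) * (2 - 2 * (ν (Iic s)).toReal)) volume a b := by
  have h1 : IntervalIntegrable (fun s : ℝ => α * s ^ (α - 1)) volume a b :=
    (intervalIntegral.intervalIntegrable_rpow' (by linarith)).const_mul α
  have hmono : Monotone fun s : ℝ => (ν (Iic s)).toReal := fun x y hxy =>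
    ENNReal.toReal_mono (measure_ne_top _ _) (measure_mono (Iic_subset_Iic.2 hxy))
  have hm := hmono.measurable
  rw [intervalIntegrable_iff] at h1 ⊢
  refine Integrable.mul_bdd (c := 2) h1 ((hm.const_mul 2).const_sub 2).aestronglyMeasurable (Eventually.of_forall fun s => ?_)
  have h2 : (ν (Iic s)).toReal ≤ 1 := measureReal_le_one
  have h3 : 0 ≤ (ν (Iic s)).toReal := ENNReal.toReal_nonneg
  rw [Real.norm_of_nonneg (by linarith)]; linarith

open Set Filter Topology in
lemma hpm_C (α : ℝ) (hα : 0 < α) (ν : Measure ℝ) [IsProbabilityMeasure ν]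
    (hsym : IsSymmetric ν) (t : ℝ) (ht : 0 < t) :
    ∫ s in (0:ℝ)..t, α * s ^ (α - 1) * (2 - 2 * (ν (Iic s)).toReal)
      = t ^ α * (1 - ∫ x, max (1 - |x / t| ^ α) 0 ∂ν) := by
  have hn : ∀ s ∈ Ioc 0 t, 0 ≤ α * s ^ (α - 1) * (2 - 2 * (ν (Iic s)).toReal) := by
    intro s hs
    have h2 : (ν (Iic s)).toReal ≤ 1 := measureReal_le_one
    have := hs.1
    exact mul_nonneg (by positivity) (by linarith)
  have hG : ∫ x, max (1 - |x / t| ^ α) 0 ∂ν ≤ 1 := by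
    have : ∫ x, max (1 - |x / t| ^ α) 0 ∂ν ≤ ∫ x, (1:ℝ) ∂ν := by
      refine integral_mono_of_nonneg (Eventually.of_forall fun x => le_max_right _ _)
        (integrable_const _) (Eventually.of_forall fun x => max_le ?_ zero_le_one)
      have : 0 ≤ |x / t| ^ α := by positivity
      linarith
    simpa using this
  have hi := hpm_bint α hα ν 0 t
  rw [intervalIntegrable_iff, uIoc_of_le ht.le] at hi
  have hae := (ae_restrict_iff' (μ := volume) measurableSet_Ioc).2 (Eventually.of_forall hn)
  rw [← ENNReal.ofReal_eq_ofReal_iff, hpm_B α hα ν t ht, hpm_layer α hα ν hsym t ht,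
    intervalIntegral.integral_of_le ht.le, ofReal_integral_eq_lintegral_ofReal hi hae]
  · rw [intervalIntegral.integral_of_le ht.le]
    exact integral_nonneg_of_ae hae
  · exact mul_nonneg (by positivity) (by linarith)

open Set Filter Topology in
/-- Right derivative of `2 t^α C / (t^α + C)`. -/
lemma hpm_deriv (α : ℝ) (hα : 0 < α) (ν : Measure ℝ) [IsProbabilityMeasure ν]
    (F G C : ℝ → ℝ) (hF : ∀ t : ℝ, F t = (ν (Iic t)).toReal)
    (hCdef : ∀ t, C t = ∫ s in (0:ℝ)..t, α * s ^ (α - 1) * (2 - 2 * (ν (Iic s)).toReal))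
    (t : ℝ) (ht : 0 < t) (hC : C t = t ^ α * (1 - G t)) (hG1 : G t ≤ 1) :
    HasDerivWithinAt (fun t => 2 * t ^ α * C t / (t ^ α + C t))
      (α * t ^ (α - 1) * (1 - (4 * F t - 2 - (G t) ^ 2) / (2 - G t) ^ 2)) (Ioi t) t := by
  have hT : 0 < t ^ α := by positivity
  have hcont : ContinuousWithinAt (fun s : ℝ => α * s ^ (α - 1) * (2 - 2 * (ν (Iic s)).toReal))
      (Ioi t) t := by
    have h1 : ContinuousWithinAt (fun s : ℝ => (ν (Iic s)).toReal) (Ioi t) t := by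
      have h := ((ProbabilityTheory.cdf ν).right_continuous t).mono Ioi_subset_Ici_self
      have e : (fun s : ℝ => (ν (Iic s)).toReal) = ProbabilityTheory.cdf ν := by
        ext s; rw [ProbabilityTheory.cdf_eq_real]; rfl
      rw [e]; exact h
    have h2 : ContinuousAt (fun s : ℝ => s ^ (α - 1)) t :=
      Real.continuousAt_rpow_const _ _ (Or.inl ht.ne')
    exact (continuousWithinAt_const.mul h2.continuousWithinAt).mul
      (continuousWithinAt_const.sub (continuousWithinAt_const.mul h1))
  have hdC : HasDerivWithinAt C (α * t ^ (α - 1) * (2 - 2 * F t)) (Ioi t) t := by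
    have hm : StronglyMeasurableAtFilter
        (fun s : ℝ => α * s ^ (α - 1) * (2 - 2 * (ν (Iic s)).toReal)) (𝓝[Ioi t] t) := by
      have hmono : Monotone fun s : ℝ => (ν (Iic s)).toReal := fun x y hxy =>
        ENNReal.toReal_mono (measure_ne_top _ _) (measure_mono (Iic_subset_Iic.2 hxy))
      have hm1 : Measurable fun s : ℝ => α * s ^ (α - 1) := by fun_prop
      exact ((hm1.mul ((hmono.measurable.const_mul 2).const_sub 2)).stronglyMeasurable
        ).stronglyMeasurableAtFilter
    have := intervalIntegral.integral_hasDerivWithinAt_right (hpm_bint α hα ν 0 t)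
      (s := Ici t) (t := Ioi t) hm hcont
    rw [funext hCdef, hF]
    exact this.mono Ioi_subset_Ici_self
  have hdT : HasDerivWithinAt (fun t : ℝ => t ^ α) (α * t ^ (α - 1)) (Ioi t) t :=
    (Real.hasDerivAt_rpow_const (Or.inl ht.ne')).hasDerivWithinAt
  have hne : t ^ α + C t ≠ 0 := by
    rw [hC]
    have := mul_nonneg hT.le (by linarith : (0:ℝ) ≤ 1 - G t)
    positivity
  have := ((hdT.const_mul 2).mul hdC).div (hdT.add hdC) hne
  refine this.congr_deriv ?_
  have h2 : 2 - G t ≠ 0 := by linarith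
  have e : t ^ α + C t = t ^ α * (2 - G t) := by rw [hC]; ring
  simp only [Pi.mul_apply, Pi.add_apply]
  rw [e, hC]
  field_simp
  ring

/-- `E[X_{τ₀⁺}^α] = 2 E|Y₁|^α`: in terms of the CDF
`P(X_{τ₀⁺} < t) = (4F(t) - 2 - G(t)²)/(2 - G(t))²` of the position at the first hitting
time of `(0,∞)`, `∫₀^∞ α t^{α-1}(1 - (4F(t) - 2 - G(t)²)/(2 - G(t))²) dt
= 4 ∫_{(0,∞)} u^α ν(du)` as an identity in `[0,∞]`. -/
theorem hitting_position_moment (α : ℝ) (hα : 0 < α)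
    (ν : Measure ℝ) [IsProbabilityMeasure ν] (hsym : IsSymmetric ν) (h0 : ν {0} = 0)
    (F G : ℝ → ℝ)
    (hF : ∀ t : ℝ, F t = (ν (Set.Iic t)).toReal)
    (hG : ∀ t : ℝ, 0 < t → G t = ∫ x, max (1 - |x / t| ^ α) 0 ∂ν) :
    ∫⁻ t in Set.Ioi (0 : ℝ),
        ENNReal.ofReal (α * t ^ (α - 1) *
          (1 - (4 * F t - 2 - (G t) ^ 2) / (2 - G t) ^ 2)) =
      4 * ∫⁻ u in Set.Ioi (0 : ℝ), ENNReal.ofReal (u ^ α) ∂ν := by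
  open Set Filter Topology in
  have hb : ∀ t x : ℝ, 0 ≤ max (1 - |x / t| ^ α) 0 ∧ max (1 - |x / t| ^ α) 0 ≤ 1 := fun t x =>
    ⟨le_max_right _ _, max_le (by have : 0 ≤ |x / t| ^ α := by positivity
                                  linarith) zero_le_one⟩
  have hG1 : ∀ t, 0 < t → G t ≤ 1 := by
    intro t ht
    rw [hG t ht]
    have : ∫ x, max (1 - |x / t| ^ α) 0 ∂ν ≤ ∫ x, (1:ℝ) ∂ν :=
      integral_mono_of_nonneg (Eventually.of_forall fun x => (hb t x).1)
        (integrable_const _) (Eventually.of_forall fun x => (hb t x).2)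
    simpa using this
  have hF1 : ∀ t, F t ≤ 1 := fun t => by rw [hF]; exact measureReal_le_one
  obtain ⟨C, hCdef⟩ : ∃ C : ℝ → ℝ, ∀ t, C t =
    ∫ s in (0:ℝ)..t, α * s ^ (α - 1) * (2 - 2 * (ν (Iic s)).toReal) := ⟨_, fun _ => rfl⟩
  have hC : ∀ t, 0 < t → C t = t ^ α * (1 - G t) := fun t ht => by
    rw [hCdef, hpm_C α hα ν hsym t ht, hG t ht]
  have hC0 : ∀ t, 0 ≤ t → 0 ≤ C t := by
    intro t ht
    rcases ht.eq_or_lt with rfl | ht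
    · simp [hCdef]
    · rw [hC t ht]; exact mul_nonneg (by positivity) (by linarith [hG1 t ht])
  have hCc : Continuous C := by
    rw [funext hCdef]
    exact intervalIntegral.continuous_primitive (hpm_bint α hα ν) 0
  set P : ℝ → ℝ := fun t => 2 * t ^ α * C t / (t ^ α + C t) with hP
  have hPc : ∀ n, ContinuousOn P (Icc 0 n) := by
    intro n t ht
    have hTc : Continuous fun t : ℝ => t ^ α := Real.continuous_rpow_const hα.le
    rcases ht.1.eq_or_lt with rfl | ht0
    · have hP0 : P 0 = 0 := by simp [hP, Real.zero_rpow hα.ne']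
      rw [ContinuousWithinAt, hP0]
      have hlim : Tendsto (fun t : ℝ => 2 * t ^ α) (𝓝[Icc 0 n] 0) (𝓝 0) := by
        have := ((hTc.const_mul 2).tendsto 0).mono_left (nhdsWithin_le_nhds (s := Icc 0 n))
        simpa [Real.zero_rpow hα.ne'] using this
      refine tendsto_of_tendsto_of_tendsto_of_le_of_le' tendsto_const_nhds hlim ?_ ?_
      · filter_upwards [self_mem_nhdsWithin] with s hs
        have h1 := hC0 s hs.1
        have h2 : 0 ≤ s ^ α := Real.rpow_nonneg hs.1 _
        simp only [hP]; positivity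
      · filter_upwards [self_mem_nhdsWithin] with s hs
        have h1 := hC0 s hs.1
        have h2 : 0 ≤ s ^ α := Real.rpow_nonneg hs.1 _
        simp only [hP]
        refine div_le_of_le_mul₀ (by positivity) (by positivity) ?_
        nlinarith
    · have h1 := hC0 t ht.1
      have h2 : 0 < t ^ α := by positivity
      exact (((continuous_const.mul hTc).mul hCc).continuousAt.div
        (hTc.add hCc).continuousAt (add_pos_of_pos_of_nonneg h2 h1).ne').continuousWithinAt
  set f : ℝ → ℝ := fun t => α * t ^ (α - 1) *
          (1 - (4 * F t - 2 - (G t) ^ 2) / (2 - G t) ^ 2) with hf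
  have hd : ∀ t, 0 < t → HasDerivWithinAt P (f t) (Ioi t) t := fun t ht =>
    hpm_deriv α hα ν F G C hF hCdef t ht (hC t ht) (hG1 t ht)
  have hf0 : ∀ t, 0 < t → 0 ≤ f t := by
    intro t ht
    refine mul_nonneg (by positivity) ?_
    have h1 : 0 < 2 - G t := by linarith [hG1 t ht]
    rw [sub_nonneg, div_le_one (by positivity)]
    nlinarith [hF1 t, sq_nonneg (1 - G t)]
  have hInt : ∀ n : ℕ, ∫⁻ t in Ioc (0:ℝ) n, ENNReal.ofReal (f t) = ENNReal.ofReal (P n) := by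
    intro n
    have hn : (0:ℝ) ≤ n := Nat.cast_nonneg n
    have hi : IntegrableOn f (Ioc (0:ℝ) n) :=
      intervalIntegral.integrableOn_deriv_right_of_nonneg (hPc n) (fun x hx => hd x hx.1)
        (fun x hx => hf0 x hx.1)
    rw [← ofReal_integral_eq_lintegral_ofReal hi
      ((ae_restrict_iff' measurableSet_Ioc).2 (Eventually.of_forall fun x hx => hf0 x hx.1)),
      ← intervalIntegral.integral_of_le hn,
      intervalIntegral.integral_eq_sub_of_hasDeriv_right_of_le hn (hPc n)
        (fun x hx => hd x hx.1) ((intervalIntegrable_iff_integrableOn_Ioc_of_le hn).2 hi)]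
    have hP0 : P 0 = 0 := by simp [hP, Real.zero_rpow hα.ne']
    rw [hP0, sub_zero]
  have hmonoS : Monotone fun n : ℕ => Ioc (0:ℝ) n := fun m n hmn =>
    Ioc_subset_Ioc_right (by exact_mod_cast hmn)
  have hU : ⋃ n : ℕ, Ioc (0:ℝ) n = Ioi 0 := by
    ext x
    simp only [mem_iUnion, mem_Ioc, mem_Ioi]
    exact ⟨fun ⟨_, h⟩ => h.1, fun h => let ⟨n, hn⟩ := exists_nat_ge x; ⟨n, h, hn⟩⟩
  rw [← hU, setLIntegral_iUnion_of_directed _ hmonoS.directed_le, hU]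
  have hT1 : Tendsto (fun n : ℕ => ∫⁻ t in Ioc (0:ℝ) n, ENNReal.ofReal (f t)) atTop
      (𝓝 (⨆ n : ℕ, ∫⁻ t in Ioc (0:ℝ) n, ENNReal.ofReal (f t))) :=
    tendsto_atTop_iSup fun m n hmn => lintegral_mono_set (hmonoS hmn)
  have hnat : Tendsto (fun n : ℕ => (n:ℝ)) atTop atTop := tendsto_natCast_atTop_atTop
  have hGlim : Tendsto (fun n : ℕ => G n) atTop (𝓝 1) := by
    have h : Tendsto (fun n : ℕ => ∫ x, max (1 - |x / (n:ℝ)| ^ α) 0 ∂ν) atTop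
        (𝓝 (∫ x, (1:ℝ) ∂ν)) := by
      refine tendsto_integral_of_dominated_convergence (fun _ => (1:ℝ))
        (fun n => Measurable.aestronglyMeasurable (by fun_prop)) (integrable_const _)
        (fun n => Eventually.of_forall fun x => ?_) (Eventually.of_forall fun x => ?_)
      · rw [Real.norm_of_nonneg (hb n x).1]; exact (hb n x).2
      · have h1 : Tendsto (fun n : ℕ => x / (n:ℝ)) atTop (𝓝 0) := hnat.const_div_atTop x
        have hc : Continuous fun y : ℝ => max (1 - |y| ^ α) 0 :=
          (continuous_const.sub ((Real.continuous_rpow_const hα.le).comp continuous_abs)).max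
            continuous_const
        have := (hc.tendsto 0).comp h1
        simpa [Real.zero_rpow hα.ne', Function.comp_def] using this
    simp only [integral_const, probReal_univ, smul_eq_mul, mul_one] at h
    refine h.congr' ?_
    filter_upwards [eventually_gt_atTop 0] with n hn
    rw [hG n (by exact_mod_cast hn)]
  have hBlim : Tendsto (fun n : ℕ => ∫⁻ x, ENNReal.ofReal ((min |x| n) ^ α) ∂ν) atTop
      (𝓝 (∫⁻ x, ENNReal.ofReal (|x| ^ α) ∂ν)) := by
    refine lintegral_tendsto_of_tendsto_of_monotone
      (fun n => Measurable.aemeasurable (by fun_prop)) (Eventually.of_forall fun x => ?_)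
      (Eventually.of_forall fun x => ?_)
    · intro m n hmn
      refine ENNReal.ofReal_le_ofReal (Real.rpow_le_rpow (le_min (abs_nonneg _) (by positivity))
        (min_le_min_left _ (by exact_mod_cast hmn)) hα.le)
    · refine tendsto_const_nhds.congr' ?_
      filter_upwards [hnat.eventually_ge_atTop |x|] with n hn
      rw [min_eq_left hn]
  have hT2 : Tendsto (fun n : ℕ => ENNReal.ofReal (2 / (2 - G n)) *
      ∫⁻ x, ENNReal.ofReal ((min |x| n) ^ α) ∂ν) atTop
      (𝓝 (2 * ∫⁻ x, ENNReal.ofReal (|x| ^ α) ∂ν)) := by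
    have h1 : Tendsto (fun n : ℕ => ENNReal.ofReal (2 / (2 - G n))) atTop (𝓝 2) := by
      have h := (tendsto_const_nhds (x := (2:ℝ))).div
        ((tendsto_const_nhds (x := (2:ℝ))).sub hGlim) (by norm_num)
      have h' := ENNReal.tendsto_ofReal h
      norm_num at h'
      exact h'
    exact ENNReal.Tendsto.mul h1 (Or.inl (by norm_num)) hBlim (Or.inr (by norm_num))
  have hT3 : Tendsto (fun n : ℕ => ∫⁻ t in Ioc (0:ℝ) n, ENNReal.ofReal (f t)) atTop
      (𝓝 (2 * ∫⁻ x, ENNReal.ofReal (|x| ^ α) ∂ν)) := by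
    refine hT2.congr' ?_
    filter_upwards [eventually_gt_atTop 0] with n hn
    have hn' : (0:ℝ) < n := by exact_mod_cast hn
    have h1 : 0 < 2 - G n := by linarith [hG1 n hn']
    have hT : 0 < (n:ℝ) ^ α := by positivity
    rw [hInt, ← hpm_B α hα ν n hn', ← hG n hn', ← ENNReal.ofReal_mul (by positivity)]
    congr 1
    simp only [hP]
    rw [show (n:ℝ) ^ α + C n = (n:ℝ) ^ α * (2 - G n) by rw [hC n hn']; ring, hC n hn']
    field_simp
  rw [tendsto_nhds_unique hT1 hT3, hpm_sym α hα ν hsym, ← mul_assoc]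
  norm_num
end
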